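/- arXiv:2102.13041 — 2 statements merged into one kernel-verified Lean document; each statement's English description precedes it below -/
import Mathlib

section
/- (Compactness) Let d ≥ 2, s ≥ 1, and let {r_n} ⊂ (0,+∞) with r_n → 0⁺. Let U ⊂ ℝ^d be an open bounded set and let {E_n} be measurable subsets of U such that J̃_{r_n}^s(E_n) ≤ M·σ^s(r_n) for every n, for some constant M independent of n. Then there exist a subsequence and a measurable set E ⊆ ℝ^d of finite Lebesgue measure and finite perimeter such that the characteristic functions χ_{E_{n_k}} converge to χ_E strongly in L¹(ℝ^d). -/
open MeasureTheory Filter Set Metric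
open scoped ENNReal NNReal symmDiff

noncomputable section

abbrev Euc (d : ℕ) : Type := EuclideanSpace ℝ (Fin d)

/-- The kernel `k^s_r`. -/
def ker (d : ℕ) (s r t : ℝ) : ℝ :=
  if t ≤ r then r ^ (-((d : ℝ) + s)) else t ^ (-((d : ℝ) + s))

/-- The regularized `s`-fractional perimeter `J̃_r^s(E) = ∫_E ∫_{Eᶜ} k^s_r(|x-y|) dy dx`. -/
def Jt (d : ℕ) (s r : ℝ) (E : Set (Euc d)) : ℝ≥0∞ :=
  ∫⁻ x in E, ∫⁻ y in Eᶜ, ENNReal.ofReal (ker d s r (dist x y))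

/-- The scaling factor `σ^s(r)`. -/
def sgm (d : ℕ) (s r : ℝ) : ℝ :=
  if s = 1 then |Real.log r| else (((d : ℝ) + s) / ((d : ℝ) + 1)) * r ^ (1 - s) / (s - 1)

/-- The scaling factor `β(r,s)` for the simultaneous limit. -/
def betaScale (d : ℕ) (s r : ℝ) : ℝ :=
  (((d : ℝ) + s) / ((d : ℝ) + 1)) * ((r ^ (1 - s) - 1) / (s - 1)) + 1 / ((d : ℝ) + 1)

/-- `ω_k`: Lebesgue measure of the unit ball in `ℝ^k`. -/
def omegaB (k : ℕ) : ℝ := (volume (ball (0 : Euc k) 1)).toReal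

/-- Divergence of a vector field on `ℝ^d`. -/
def diverg {d : ℕ} (Φ : Euc d → Euc d) (x : Euc d) : ℝ :=
  ∑ i : Fin d, fderiv ℝ Φ x (EuclideanSpace.single i 1) i

/-- De Giorgi perimeter. -/
def Per (d : ℕ) (E : Set (Euc d)) : ℝ≥0∞ :=
  ⨆ (Φ : Euc d → Euc d) (_ : ContDiff ℝ 1 Φ) (_ : HasCompactSupport Φ)
    (_ : ∀ x, ‖Φ x‖ ≤ 1), ENNReal.ofReal (∫ x in E, diverg Φ x)

/-- The cube `lQ + ξ` where `Q = [-1/2, 1/2)^d`. -/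
def cube (d : ℕ) (l : ℝ) (ξ : Euc d) : Set (Euc d) :=
  {x | ∀ i, x i ∈ Set.Ico (ξ i - l / 2) (ξ i + l / 2)}

/-- Half space `H⁻_ν(0)`. -/
def Hminus (d : ℕ) (ν : Euc d) : Set (Euc d) := {y | @inner ℝ _ _ ν y ≤ 0}

/-- Standard (normalized) `k`-dimensional Hausdorff measure on `ℝ^d`:
Mathlib's `μH[k]` uses `diam^k` gauges without the normalizing constant `ω_k/2^k`. -/
def Hstd (d : ℕ) (k : ℕ) : Measure (Euc d) :=
  (ENNReal.ofReal (omegaB k / 2 ^ k)) • (μH[(k : ℝ)] : Measure (Euc d))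

/-- The nonlocal `k^s_r`-curvature. -/
def curv (d : ℕ) (s r : ℝ) (E : Set (Euc d)) (x : Euc d) : ℝ :=
  ∫ y, (Set.indicator Eᶜ (fun _ => (1 : ℝ)) y - Set.indicator E (fun _ => (1 : ℝ)) y)
    * ker d s r (dist x y)

/-- The class `𝔈`: closures of open sets with compact `C²` boundary. -/
def IsC2Domain (d : ℕ) (E : Set (Euc d)) : Prop :=
  ∃ U : Set (Euc d), IsOpen U ∧ E = closure U ∧ IsCompact (frontier U) ∧
    ∃ f : Euc d → ℝ, ContDiff ℝ 2 f ∧ U = {x | f x < 0} ∧ frontier U = {x | f x = 0} ∧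
      ∀ x ∈ frontier U, fderiv ℝ f x ≠ 0


def GG {d : ℕ} (E : Set (Euc d)) (h : Euc d) : ℝ≥0∞ :=
  volume (E ∆ ((fun x => x + h) ⁻¹' E))

lemma GG_meas {d : ℕ} {E : Set (Euc d)} (hE : MeasurableSet E) : Measurable (GG E) := by
  have : MeasurableSet ((Prod.snd ⁻¹' E) ∆ ((fun p : Euc d × Euc d => p.2 + p.1) ⁻¹' E)) :=
    (measurable_snd hE).symmDiff ((measurable_snd.add measurable_fst) hE)
  exact measurable_measure_prodMk_left this

lemma GG_add {d : ℕ} {E : Set (Euc d)} (h k : Euc d) :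
    GG E (h + k) ≤ GG E h + GG E k := by
  unfold GG
  have h1 : volume (E ∆ ((fun x => x + k) ⁻¹' E)) =
      volume ((fun x => x + h) ⁻¹' (E ∆ ((fun x => x + k) ⁻¹' E))) :=
    (measure_preimage_add_right volume h _).symm
  rw [h1]
  refine (measure_mono ?_).trans (measure_union_le _ _)
  intro x
  simp only [mem_symmDiff, mem_preimage, mem_union, ← add_assoc]
  tauto

lemma GG_neg {d : ℕ} {E : Set (Euc d)} (h : Euc d) : GG E (-h) = GG E h := by
  unfold GG
  rw [← measure_preimage_add_right volume h (E ∆ _)]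
  congr 1
  ext x
  simp only [mem_symmDiff, mem_preimage, add_neg_cancel_right]
  tauto

lemma GG_zero {d : ℕ} {E : Set (Euc d)} : GG E 0 = 0 := by
  simp [GG]

lemma GG_nsmul {d : ℕ} {E : Set (Euc d)} (h : Euc d) (n : ℕ) :
    GG E (n • h) ≤ n * GG E h := by
  induction n with
  | zero => simp [GG_zero]
  | succ n ih =>
    rw [succ_nsmul]
    push_cast
    rw [add_mul, one_mul]
    exact (GG_add _ _).trans (by gcongr)

/-- one-sided version -/
lemma GG_eq {d : ℕ} {E : Set (Euc d)} (hE : MeasurableSet E) (hf : volume E ≠ ⊤) (h : Euc d) :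
    GG E h = 2 * volume (E \ ((fun x => x + h) ⁻¹' E)) := by
  have hm : MeasurableSet ((fun x => x + h) ⁻¹' E) := (measurable_id.add_const h) hE
  have he : volume ((fun x => x + h) ⁻¹' E) = volume E := measure_preimage_add_right volume h _
  unfold GG
  rw [measure_symmDiff_eq hE.nullMeasurableSet hm.nullMeasurableSet, two_mul]
  congr 1
  have h1 := measure_sdiff_add_inter (μ := volume) ((fun x => x + h) ⁻¹' E) hE
  have h2 := measure_sdiff_add_inter (μ := volume) E hm
  rw [he, ← h2, inter_comm] at h1
  exact (ENNReal.add_left_inj (measure_ne_top_of_subset inter_subset_left hf)).1 h1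

lemma ker_meas (d : ℕ) (s r : ℝ) : Measurable (_root_.ker d s r) := by
  unfold _root_.ker
  exact Measurable.ite measurableSet_Iic measurable_const (by fun_prop)

lemma Jt_eq {d : ℕ} {E : Set (Euc d)} (hE : MeasurableSet E) (hf : volume E ≠ ⊤) (s r : ℝ) :
    2 * Jt d s r E = ∫⁻ h, ENNReal.ofReal (_root_.ker d s r ‖h‖) * GG E h := by
  have hk : Measurable fun h : Euc d => ENNReal.ofReal (_root_.ker d s r ‖h‖) :=
    ((ker_meas d s r).comp measurable_norm).ennreal_ofReal
  have hset : MeasurableSet {p : Euc d × Euc d | p.1 ∈ E ∧ p.1 + p.2 ∉ E} :=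
    (measurable_fst hE).inter ((measurable_fst.add measurable_snd) hE.compl)
  have e1 : Jt d s r E = ∫⁻ x, ∫⁻ h, ENNReal.ofReal (_root_.ker d s r ‖h‖) *
      {p : Euc d × Euc d | p.1 ∈ E ∧ p.1 + p.2 ∉ E}.indicator 1 (x, h) := by
    unfold Jt
    rw [← lintegral_indicator hE]
    refine lintegral_congr fun x => ?_
    by_cases hx : x ∈ E
    · rw [indicator_of_mem hx, ← lintegral_indicator hE.compl,
        ← lintegral_add_left_eq_self _ x]
      refine lintegral_congr fun h => ?_
      by_cases hh : x + h ∈ E <;> simp [hx, hh, indicator]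
    · simp [hx, indicator]
  rw [e1, lintegral_lintegral_swap, ← lintegral_const_mul' _ _ (by simp)]
  · refine lintegral_congr fun h => ?_
    rw [lintegral_const_mul, GG_eq hE hf]
    · have : volume (E \ ((fun x => x + h) ⁻¹' E)) =
        ∫⁻ x, {p : Euc d × Euc d | p.1 ∈ E ∧ p.1 + p.2 ∉ E}.indicator 1 (x, h) := by
        have hm : MeasurableSet ((fun x => x + h) ⁻¹' E) := (measurable_id.add_const h) hE
        rw [← lintegral_indicator_one (hE.diff hm)]
        rfl
      rw [this]; ring
    · exact (measurable_one.indicator hset).comp (measurable_id.prodMk measurable_const)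
  · exact ((hk.comp measurable_snd).mul (measurable_one.indicator hset)).aemeasurable

/-- averaging: bound on small translations -/
lemma GG_small {d : ℕ} (hd : 2 ≤ d) {E : Set (Euc d)} (hE : MeasurableSet E) {ρ : ℝ} (hρ : 0 < ρ)
    {h : Euc d} (hh : ‖h‖ ≤ ρ / 4) :
    volume (ball (0 : Euc d) (ρ / 4)) * GG E h ≤
      2 * ∫⁻ z in {z : Euc d | ρ < ‖z‖ ∧ ‖z‖ ≤ 2 * ρ}, GG E z := by
  have : Nonempty (Fin d) := ⟨⟨0, by omega⟩⟩
  obtain ⟨c, hc⟩ : ∃ c : Euc d, ‖c‖ = 3 / 2 * ρ :=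
    ⟨EuclideanSpace.single ⟨0, by omega⟩ (3 / 2 * ρ), by simp [abs_of_pos hρ]⟩
  set A := {z : Euc d | ρ < ‖z‖ ∧ ‖z‖ ≤ 2 * ρ} with hA
  have hAm : MeasurableSet A :=
    (measurableSet_lt measurable_const measurable_norm).inter
      (measurableSet_le measurable_norm measurable_const)
  have hG := GG_meas hE
  have e1 : volume (ball (0 : Euc d) (ρ / 4)) * GG E h = ∫⁻ z in ball c (ρ / 4), GG E h := by
    rw [setLIntegral_const, mul_comm, Measure.addHaar_ball_center volume c]
  rw [e1, two_mul]
  have key : ∀ z ∈ ball c (ρ / 4), z ∈ A ∧ h - z ∈ A := by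
    intro z hz
    rw [mem_ball, dist_eq_norm] at hz
    have a1 := norm_sub_norm_le c z
    have a2 := norm_sub_norm_le z c
    rw [norm_sub_rev] at a1
    have a3 := norm_sub_le h z
    have a4 := norm_sub_norm_le z h
    rw [norm_sub_rev] at a4
    refine ⟨⟨by linarith, by linarith⟩, ⟨by linarith, by linarith⟩⟩
  calc ∫⁻ z in ball c (ρ / 4), GG E h
      ≤ ∫⁻ z in ball c (ρ / 4), (A.indicator (GG E) z + A.indicator (GG E) (h - z)) := by
        refine setLIntegral_mono' measurableSet_ball fun z hz => ?_
        obtain ⟨h1, h2⟩ := key z hz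
        rw [indicator_of_mem h1, indicator_of_mem h2]
        have := GG_add (E := E) z (h - z)
        simpa using this
    _ ≤ ∫⁻ z, (A.indicator (GG E) z + A.indicator (GG E) (h - z)) := setLIntegral_le_lintegral _ _
    _ = _ := by
        rw [lintegral_add_left (hG.indicator hAm), lintegral_sub_left_eq_self (A.indicator (GG E)) h,
          lintegral_indicator hAm]

lemma GG_lin {d : ℕ} (hd : 2 ≤ d) {C : ℝ} (hC : 0 ≤ C) : ∃ C' : ℝ, 0 ≤ C' ∧ ∀ (E : Set (Euc d)),
    MeasurableSet E → ∀ ρ : ℝ, 0 < ρ →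
    ∫⁻ z in {z : Euc d | ρ < ‖z‖ ∧ ‖z‖ ≤ 2 * ρ}, GG E z ≤ ENNReal.ofReal (C * ρ ^ (d + 1)) →
    ∀ h, GG E h ≤ ENNReal.ofReal (C' * (‖h‖ + ρ)) := by
  have : Nonempty (Fin d) := ⟨⟨0, by omega⟩⟩
  set ω := (volume (ball (0 : Euc d) 1)).toReal with hω
  have hωt : volume (ball (0 : Euc d) 1) ≠ ⊤ := measure_ball_lt_top.ne
  have hωp : 0 < ω := ENNReal.toReal_pos (measure_ball_pos _ _ one_pos).ne' hωt
  refine ⟨4 * (2 * C * 4 ^ d / ω), by positivity, fun E hE ρ hρ hI h => ?_⟩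
  set C1 := 2 * C * 4 ^ d / ω with hC1
  have hC1p : 0 ≤ C1 := by positivity
  have small : ∀ k : Euc d, ‖k‖ ≤ ρ / 4 → GG E k ≤ ENNReal.ofReal (C1 * ρ) := by
    intro k hk
    have h1 := GG_small hd hE hρ hk
    have h2 : volume (ball (0 : Euc d) (ρ / 4)) = ENNReal.ofReal ((ρ / 4) ^ d * ω) := by
      rw [Measure.addHaar_ball _ _ (by positivity), finrank_euclideanSpace_fin,
        ENNReal.ofReal_mul (by positivity), hω, ENNReal.ofReal_toReal hωt]
    rw [h2] at h1
    have h3 : ENNReal.ofReal ((ρ / 4) ^ d * ω) * GG E k ≤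
        ENNReal.ofReal ((ρ / 4) ^ d * ω) * ENNReal.ofReal (C1 * ρ) := by
      refine h1.trans ?_
      rw [← ENNReal.ofReal_mul (by positivity)]
      have : (ρ / 4) ^ d * ω * (C1 * ρ) = 2 * (C * ρ ^ (d + 1)) := by
        rw [hC1, div_pow]; field_simp; ring
      rw [this, ENNReal.ofReal_mul (by norm_num)]
      gcongr
      simp
    exact (ENNReal.mul_le_mul_iff_right (by simp; positivity) (by simp)).1 h3
  set N := ⌈4 * ‖h‖ / ρ⌉₊ + 1 with hN
  have hNp : (0:ℝ) < N := by positivity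
  have hN1 : 4 * ‖h‖ / ρ ≤ N := by
    rw [hN]; push_cast; linarith [Nat.le_ceil (4 * ‖h‖ / ρ)]
  have hN2 : (N:ℝ) ≤ 4 * ‖h‖ / ρ + 2 := by
    rw [hN]; push_cast; linarith [Nat.ceil_lt_add_one (a := 4 * ‖h‖ / ρ) (by positivity)]
  have hh : h = N • ((N:ℝ)⁻¹ • h) := by
    rw [← Nat.cast_smul_eq_nsmul ℝ, smul_smul, mul_inv_cancel₀ hNp.ne', one_smul]
  have hk : ‖(N:ℝ)⁻¹ • h‖ ≤ ρ / 4 := by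
    rw [norm_smul, norm_inv, Real.norm_of_nonneg hNp.le, inv_mul_le_iff₀ hNp]
    rw [div_le_iff₀ hρ] at hN1
    linarith
  rw [hh]
  refine (GG_nsmul _ _).trans ?_
  rw [← hh]
  refine (mul_le_mul_right (small _ hk) _).trans ?_
  rw [← ENNReal.ofReal_natCast, ← ENNReal.ofReal_mul (by positivity)]
  apply ENNReal.ofReal_le_ofReal
  have : (N:ℝ) * ρ ≤ 4 * ‖h‖ + 2 * ρ := by
    have := mul_le_mul_of_nonneg_right hN2 hρ.le
    rwa [add_mul, div_mul_cancel₀ _ hρ.ne'] at this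
  nlinarith [norm_nonneg h]

def Ann (d : ℕ) (ρ : ℝ) : Set (Euc d) := {z : Euc d | ρ < ‖z‖ ∧ ‖z‖ ≤ 2 * ρ}

lemma Ann_meas (d : ℕ) (ρ : ℝ) : MeasurableSet (Ann d ρ) :=
    (measurableSet_lt measurable_const measurable_norm).inter
      (measurableSet_le measurable_norm measurable_const)

lemma ann_lower {d : ℕ} {s : ℝ} (hs : 1 ≤ s) {r ρ : ℝ} (hr : 0 < r) (hρ : r ≤ ρ) (E : Set (Euc d)) :
    ENNReal.ofReal ((2 * ρ) ^ (-((d:ℝ) + s))) * ∫⁻ z in Ann d ρ, GG E z ≤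
      ∫⁻ z in Ann d ρ, ENNReal.ofReal (_root_.ker d s r ‖z‖) * GG E z := by
  rw [← lintegral_const_mul' _ _ (by simp)]
  refine setLIntegral_mono' (Ann_meas d ρ) fun z hz => ?_
  gcongr
  have : ¬ ‖z‖ ≤ r := not_le.2 (hρ.trans_lt hz.1)
  rw [_root_.ker, if_neg this]
  refine Real.rpow_le_rpow_of_nonpos (by linarith [hz.1]) hz.2 ?_
  have : (0:ℝ) ≤ d := by positivity
  linarith

lemma div_help {a X : ℝ} (ha : 0 < a) {I : ℝ≥0∞} (h : ENNReal.ofReal a * I ≤ ENNReal.ofReal X) :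
    I ≤ ENNReal.ofReal (X / a) := by
  rw [ENNReal.ofReal_div_of_pos ha, ENNReal.le_div_iff_mul_le (by simp [ha]) (by simp), mul_comm]
  exact h

lemma two_mul_help {d : ℕ} {E : Set (Euc d)} {s r M σ : ℝ} (hσ : 0 ≤ σ)
    (h : Jt d s r E ≤ ENNReal.ofReal (M * σ)) :
    2 * Jt d s r E ≤ ENNReal.ofReal (2 * |M| * σ) := by
  rw [mul_assoc, ENNReal.ofReal_mul (by norm_num)]
  have : M * σ ≤ |M| * σ := mul_le_mul_of_nonneg_right (le_abs_self M) hσ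
  have := h.trans (ENNReal.ofReal_le_ofReal this)
  simpa using mul_le_mul_right this 2

lemma scale_gt {d : ℕ} {s : ℝ} (hs : 1 < s) (M : ℝ) :
    ∃ C : ℝ, 0 ≤ C ∧ ∃ r0 : ℝ, 0 < r0 ∧ ∀ r : ℝ, 0 < r → r < r0 → ∀ E : Set (Euc d),
      MeasurableSet E → volume E ≠ ⊤ → Jt d s r E ≤ ENNReal.ofReal (M * sgm d s r) →
      ∃ ρ : ℝ, 0 < ρ ∧ ρ ≤ √r ∧ ∫⁻ z in Ann d ρ, GG E z ≤ ENNReal.ofReal (C * ρ ^ (d + 1)) := by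
  have hd0 : (0:ℝ) ≤ d := by positivity
  have hs1 : 0 < s - 1 := by linarith
  refine ⟨2 * |M| * (((d : ℝ) + s) / ((d : ℝ) + 1) / (s - 1)) * 2 ^ ((d:ℝ) + s), by positivity,
    1, one_pos, fun r hr hr1 E hE hf hJ => ⟨r, hr, ?_, ?_⟩⟩
  · apply Real.le_sqrt_of_sq_le; nlinarith
  · have hσ : sgm d s r = (((d : ℝ) + s) / ((d : ℝ) + 1)) * r ^ (1 - s) / (s - 1) := by
      rw [sgm, if_neg hs.ne']
    have h1 := two_mul_help (by rw [hσ]; positivity) hJ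
    rw [Jt_eq hE hf] at h1
    have h2 := ((ann_lower hs.le hr le_rfl E).trans (setLIntegral_le_lintegral _ _)).trans h1
    have h3 := div_help (by positivity) h2
    refine h3.trans (ENNReal.ofReal_le_ofReal (le_of_eq ?_))
    rw [hσ, Real.rpow_neg (by positivity), div_inv_eq_mul, Real.mul_rpow (by norm_num) hr.le]
    have : r ^ (d + 1) = r ^ (1 - s) * r ^ ((d:ℝ) + s) := by
      rw [← Real.rpow_add hr, ← Real.rpow_natCast]; congr 1; push_cast; ring
    rw [this]; ring

lemma scale_one {d : ℕ} (M : ℝ) :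
    ∃ C : ℝ, 0 ≤ C ∧ ∃ r0 : ℝ, 0 < r0 ∧ ∀ r : ℝ, 0 < r → r < r0 → ∀ E : Set (Euc d),
      MeasurableSet E → volume E ≠ ⊤ → Jt d 1 r E ≤ ENNReal.ofReal (M * sgm d 1 r) →
      ∃ ρ : ℝ, 0 < ρ ∧ ρ ≤ √r ∧ ∫⁻ z in Ann d ρ, GG E z ≤ ENNReal.ofReal (C * ρ ^ (d + 1)) := by
  have hl2 : 0 < Real.log 2 := Real.log_pos (by norm_num)
  refine ⟨8 * |M| * Real.log 2 * 2 ^ (d + 1), by positivity,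
    Real.exp (-(4 * Real.log 2)), Real.exp_pos _, fun r hr hr1 E hE hf hJ => ?_⟩
  have hlog : Real.log r < -(4 * Real.log 2) := (Real.log_lt_iff_lt_exp hr).2 hr1
  set L := - Real.log r with hL
  have hL4 : 4 * Real.log 2 < L := by linarith
  have hσ : sgm d 1 r = L := by
    rw [sgm, if_pos rfl, abs_of_neg (by linarith)]
  have h1 := two_mul_help (by rw [hσ]; linarith) hJ
  rw [Jt_eq hE hf, hσ] at h1
  set K := ⌊L / (2 * Real.log 2)⌋₊ with hK
  have hx : 2 < L / (2 * Real.log 2) := by rw [lt_div_iff₀ (by positivity)]; linarith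
  have hK1 : (K:ℝ) ≤ L / (2 * Real.log 2) := Nat.floor_le (by linarith)
  have hK2 : L / (4 * Real.log 2) ≤ K := by
    have := Nat.lt_floor_add_one (L / (2 * Real.log 2))
    rw [← hK] at this
    have e : L / (4 * Real.log 2) = (L / (2 * Real.log 2)) / 2 := by field_simp; norm_num
    rw [e]; linarith
  have hK0 : 0 < K := by
    have : (0:ℝ) < K := lt_of_lt_of_le (by apply div_pos <;> linarith) hK2
    exact_mod_cast this
  have hr2 : ∀ k : ℕ, r ≤ 2 ^ k * r := fun k =>
    le_mul_of_one_le_left hr.le (one_le_pow₀ (by norm_num))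
  have hdisj : (Set.PairwiseDisjoint (↑(Finset.range K)) fun k : ℕ => Ann d (2 ^ k * r)) := by
    have aux : ∀ i j : ℕ, i < j → ∀ x, x ∈ Ann d (2 ^ i * r) → x ∈ Ann d (2 ^ j * r) → False := by
      intro i j hij x hx hy
      have a1 := hx.2
      have a2 := hy.1
      have : (2:ℝ) ^ (i + 1) ≤ 2 ^ j := pow_le_pow_right₀ (by norm_num) hij
      rw [pow_succ] at this
      nlinarith
    intro i _ j _ hij
    refine Set.disjoint_left.2 fun x hx hy => ?_
    rcases lt_or_gt_of_ne hij with h | h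
    · exact aux i j h x hx hy
    · exact aux j i h x hy hx
  have hsum : ∑ k ∈ Finset.range K, ENNReal.ofReal ((2 * (2 ^ k * r)) ^ (-((d:ℝ) + 1))) *
      ∫⁻ z in Ann d (2 ^ k * r), GG E z ≤ ∑ k ∈ Finset.range K, ENNReal.ofReal (8 * |M| * Real.log 2) := by
    calc _ ≤ ∑ k ∈ Finset.range K, ∫⁻ z in Ann d (2 ^ k * r),
          ENNReal.ofReal (_root_.ker d 1 r ‖z‖) * GG E z :=
          Finset.sum_le_sum fun k _ => ann_lower le_rfl hr (hr2 k) E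
      _ = ∫⁻ z in ⋃ k ∈ Finset.range K, Ann d (2 ^ k * r),
          ENNReal.ofReal (_root_.ker d 1 r ‖z‖) * GG E z :=
          (lintegral_biUnion_finset hdisj (fun k _ => Ann_meas d _) _).symm
      _ ≤ _ := setLIntegral_le_lintegral _ _
      _ ≤ _ := h1
      _ ≤ _ := by
        rw [Finset.sum_const, Finset.card_range, nsmul_eq_mul, ← ENNReal.ofReal_natCast,
          ← ENNReal.ofReal_mul (by positivity)]
        apply ENNReal.ofReal_le_ofReal
        rw [div_le_iff₀ (by positivity)] at hK2
        nlinarith [abs_nonneg M]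
  obtain ⟨k, hk, hkI⟩ := ENNReal.exists_le_of_sum_le (Finset.nonempty_range_iff.2 hK0.ne') hsum
  refine ⟨2 ^ k * r, by positivity, ?_, ?_⟩
  · have hkK : (k:ℝ) ≤ K := by exact_mod_cast (Finset.mem_range.1 hk).le
    have e2 : (2:ℝ) ^ k = Real.exp (k * Real.log 2) := by
      rw [Real.exp_nat_mul, Real.exp_log (by norm_num)]
    have e3 : √r = Real.exp (Real.log r / 2) := by
      rw [Real.exp_half, Real.exp_log hr]
    rw [e2, e3]
    nth_rw 1 [← Real.exp_log hr]
    rw [← Real.exp_add]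
    apply Real.exp_le_exp.2
    have := hkK.trans hK1
    rw [le_div_iff₀ (by positivity)] at this
    linarith
  · have h3 := div_help (by positivity) hkI
    refine h3.trans (ENNReal.ofReal_le_ofReal (le_of_eq ?_))
    rw [Real.rpow_neg (by positivity), div_inv_eq_mul]
    have : ((d:ℝ) + 1) = ((d + 1 : ℕ) : ℝ) := by push_cast; ring
    rw [this, Real.rpow_natCast, mul_pow 2]; ring

lemma scale {d : ℕ} {s : ℝ} (hs : 1 ≤ s) (M : ℝ) :
    ∃ C : ℝ, 0 ≤ C ∧ ∃ r0 : ℝ, 0 < r0 ∧ ∀ r : ℝ, 0 < r → r < r0 → ∀ E : Set (Euc d),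
      MeasurableSet E → volume E ≠ ⊤ → Jt d s r E ≤ ENNReal.ofReal (M * sgm d s r) →
      ∃ ρ : ℝ, 0 < ρ ∧ ρ ≤ √r ∧ ∫⁻ z in Ann d ρ, GG E z ≤ ENNReal.ofReal (C * ρ ^ (d + 1)) := by
  rcases hs.eq_or_lt with rfl | h
  · exact scale_one M
  · exact scale_gt h M

/-- the conclusion of the first part -/
lemma modulus {d : ℕ} (hd : 2 ≤ d) {s : ℝ} (hs : 1 ≤ s) (M : ℝ) :
    ∃ C : ℝ, 0 ≤ C ∧ ∃ r0 : ℝ, 0 < r0 ∧ ∀ r : ℝ, 0 < r → r < r0 → ∀ E : Set (Euc d),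
      MeasurableSet E → volume E ≠ ⊤ → Jt d s r E ≤ ENNReal.ofReal (M * sgm d s r) →
      ∀ h, GG E h ≤ ENNReal.ofReal (C * (‖h‖ + √r)) := by
  obtain ⟨C, hC, r0, hr0, H⟩ := scale (d := d) hs M
  obtain ⟨C', hC', H'⟩ := GG_lin hd hC
  refine ⟨C', hC', r0, hr0, fun r hr hr1 E hE hf hJ h => ?_⟩
  obtain ⟨ρ, hρ, hρr, hI⟩ := H r hr hr1 E hE hf hJ
  exact (H' E hE ρ hρ hI h).trans (ENNReal.ofReal_le_ofReal (by gcongr))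

lemma weak_sub {d : ℕ} (U : Set (Euc d)) (hU : Bornology.IsBounded U)
    (E : ℕ → Set (Euc d)) (hE : ∀ n, MeasurableSet (E n)) (hEU : ∀ n, E n ⊆ U) :
    ∃ φ : ℕ → ℕ, StrictMono φ ∧ ∀ S : Set (Euc d), MeasurableSet S → volume S ≠ ⊤ →
      ∃ l : ℝ≥0∞, l ≠ ⊤ ∧ Tendsto (fun n => volume (S ∩ E (φ n))) atTop (nhds l) := by
  have hUt : volume U ≠ ⊤ := hU.measure_lt_top.ne
  have hEt : ∀ n, volume (E n) ≠ ⊤ := fun n => measure_ne_top_of_subset (hEU n) hUt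
  let x : ℕ → Lp ℝ 2 (volume : Measure (Euc d)) := fun n => indicatorConstLp 2 (hE n) (hEt n) 1
  have hx : ∀ n, ‖x n‖ ≤ volume.real U ^ (1 / (2:ℝ)) := by
    intro n
    refine norm_indicatorConstLp_le.trans ?_
    simp only [norm_one, one_mul, ENNReal.toReal_ofNat]
    gcongr
    exact hEU n
  let T : ℕ → WeakDual ℝ (Lp ℝ 2 (volume : Measure (Euc d))) :=
    fun n => StrongDual.toWeakDual (InnerProductSpace.toDual ℝ _ (x n))
  have : Fact ((2:ℝ≥0∞) ≠ ⊤) := ⟨by simp⟩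
  obtain ⟨t, -, φ, hφ, ht⟩ := WeakDual.isSeqCompact_closedBall ℝ (Lp ℝ 2 (volume : Measure (Euc d)))
    0 (volume.real U ^ (1 / (2:ℝ))) (x := T) (fun n => by
      simp only [mem_preimage, mem_closedBall, dist_zero_right]
      change ‖InnerProductSpace.toDual ℝ _ (x n)‖ ≤ _
      rw [LinearIsometryEquiv.norm_map]; exact hx n)
  refine ⟨φ, hφ, fun S hS hSt => ⟨ENNReal.ofReal (t (indicatorConstLp 2 hS hSt 1)), by simp, ?_⟩⟩
  have h1 := (WeakDual.eval_continuous (indicatorConstLp 2 hS hSt (1:ℝ))).tendsto t |>.comp ht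
  have h2 := ENNReal.tendsto_ofReal h1
  refine h2.congr fun n => ?_
  have : T (φ n) (indicatorConstLp 2 hS hSt (1:ℝ)) = volume.real (S ∩ E (φ n)) := by
    change inner ℝ (x (φ n)) (indicatorConstLp 2 hS hSt (1:ℝ)) = _
    rw [L2.real_inner_indicatorConstLp_one_indicatorConstLp_one (hE (φ n)) hS (hEt (φ n)) hSt, inter_comm]
  simp only [Function.comp]
  rw [this, ofReal_measureReal (measure_ne_top_of_subset inter_subset_left hSt)]

def ww {d : ℕ} (δ : ℝ) (E : Set (Euc d)) (x : Euc d) : ℝ≥0∞ :=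
  volume (ball 0 δ ∩ {h | x + h ∈ E})

def tt {d : ℕ} (δ : ℝ) (E : Set (Euc d)) (x : Euc d) : ℝ≥0∞ :=
  volume (ball 0 δ ∩ {h | ¬ (x ∈ E ↔ x + h ∈ E)})

lemma ww_eq {d : ℕ} (δ : ℝ) (E : Set (Euc d)) (x : Euc d) : ww δ E x = volume (ball x δ ∩ E) := by
  rw [ww, ← measure_preimage_add volume x (ball x δ ∩ E)]
  congr 1
  ext h
  simp

lemma ww_meas {d : ℕ} (δ : ℝ) {E : Set (Euc d)} (hE : MeasurableSet E) : Measurable (ww δ E) := by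
  have : MeasurableSet {p : Euc d × Euc d | p.2 ∈ ball (0 : Euc d) δ ∧ p.1 + p.2 ∈ E} :=
    (measurable_snd measurableSet_ball).inter ((measurable_fst.add measurable_snd) hE)
  exact measurable_measure_prodMk_left this

lemma tt_set {d : ℕ} (δ : ℝ) {E : Set (Euc d)} (hE : MeasurableSet E) :
    MeasurableSet {p : Euc d × Euc d | p.2 ∈ ball (0 : Euc d) δ ∧ ¬ (p.1 ∈ E ↔ p.1 + p.2 ∈ E)} := by
  refine (measurable_snd measurableSet_ball).inter ?_
  exact (MeasurableSet.iff (measurable_fst hE) ((measurable_fst.add measurable_snd) hE)).compl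

lemma tt_meas {d : ℕ} (δ : ℝ) {E : Set (Euc d)} (hE : MeasurableSet E) : Measurable (tt δ E) :=
  measurable_measure_prodMk_left (tt_set δ hE)

lemma tt_int {d : ℕ} (δ : ℝ) {E : Set (Euc d)} (hE : MeasurableSet E) :
    ∫⁻ x, tt δ E x = ∫⁻ h in ball (0 : Euc d) δ, GG E h := by
  have h1 := Measure.prod_apply (μ := (volume : Measure (Euc d))) (ν := (volume : Measure (Euc d)))
    (tt_set δ hE)
  have h2 := Measure.prod_apply_symm (μ := (volume : Measure (Euc d)))
    (ν := (volume : Measure (Euc d))) (tt_set δ hE)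
  rw [← lintegral_indicator measurableSet_ball]
  refine (h1.symm.trans h2).trans (lintegral_congr fun h => ?_)
  by_cases hh : h ∈ ball (0 : Euc d) δ
  · rw [indicator_of_mem hh, GG]
    congr 1
    ext x
    simp only [mem_preimage, mem_ofPred_eq, mem_symmDiff, hh]
    tauto
  · rw [indicator_of_notMem hh]
    have : (fun x : Euc d => (x, h)) ⁻¹' {p : Euc d × Euc d | p.2 ∈ ball (0 : Euc d) δ ∧
        ¬ (p.1 ∈ E ↔ p.1 + p.2 ∈ E)} = ∅ :=
      eq_empty_of_forall_notMem fun x hx => hh hx.1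
    rw [this, measure_empty]

lemma pt_bound {d : ℕ} (δ : ℝ) {A B : Set (Euc d)} (hA : MeasurableSet A)
    {x : Euc d} (h1 : x ∈ A) (h2 : x ∉ B) :
    volume (ball (0 : Euc d) δ) ≤ tt δ A x + tt δ B x + (ww δ A x - ww δ B x) := by
  have hm : MeasurableSet {h | x + h ∈ A} := (measurable_const_add x) hA
  have e := measure_inter_add_sdiff (μ := volume) (ball (0 : Euc d) δ) hm
  have e1 : tt δ A x = volume (ball (0 : Euc d) δ \ {h | x + h ∈ A}) := by
    unfold tt; congr 1; ext h; simp [h1]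
  have e2 : tt δ B x = ww δ B x := by
    unfold tt ww; congr 1; ext h; simp [h2]
  rw [← e, ← e1, e2, add_assoc, add_comm]
  gcongr
  exact le_add_tsub

lemma key_bound {d : ℕ} (δ : ℝ) {A B : Set (Euc d)} (hA : MeasurableSet A) (hB : MeasurableSet B) :
    volume (ball (0 : Euc d) δ) * volume (A ∆ B) ≤
      (∫⁻ h in ball (0 : Euc d) δ, GG A h) + (∫⁻ h in ball (0 : Euc d) δ, GG B h) +
      ∫⁻ x, ((ww δ A x - ww δ B x) + (ww δ B x - ww δ A x)) := by
  rw [← setLIntegral_const, ← lintegral_indicator (hA.symmDiff hB), ← tt_int δ hA, ← tt_int δ hB,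
    ← lintegral_add_left (tt_meas δ hA)]
  have hm : Measurable fun x => tt δ A x + tt δ B x := (tt_meas δ hA).add (tt_meas δ hB)
  rw [← lintegral_add_left hm]
  refine lintegral_mono (Set.indicator_le fun x hx => ?_)
  rcases hx with hx | hx
  · exact (pt_bound δ hA hx.1 hx.2).trans (by gcongr; exact le_self_add)
  · refine (pt_bound δ hB hx.1 hx.2).trans ?_
    rw [add_comm (tt δ B x)]
    gcongr; exact le_add_self

lemma compact {d : ℕ} (U : Set (Euc d)) (hU : Bornology.IsBounded U)
    (E : ℕ → Set (Euc d)) (hE : ∀ n, MeasurableSet (E n)) (hEU : ∀ n, E n ⊆ U)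
    (C : ℝ) (hC : 0 ≤ C) (τ : ℕ → ℝ) (hτ : Tendsto τ atTop (nhds 0))
    (hG : ∀ᶠ n in atTop, ∀ h, GG (E n) h ≤ ENNReal.ofReal (C * (‖h‖ + τ n))) :
    ∃ φ : ℕ → ℕ, StrictMono φ ∧ ∃ F : Set (Euc d), MeasurableSet F ∧
      volume F < ⊤ ∧ Tendsto (fun k => volume ((E (φ k)) ∆ F)) atTop (nhds 0) := by
  have hUt : volume U ≠ ⊤ := hU.measure_lt_top.ne
  have hEt : ∀ n, volume (E n) ≠ ⊤ := fun n => measure_ne_top_of_subset (hEU n) hUt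
  obtain ⟨φ, hφ, hw⟩ := weak_sub U hU E hE hEU
  refine ⟨φ, hφ, ?_⟩
  obtain ⟨R, hR⟩ := hU.subset_ball (0 : Euc d)
  -- dominated convergence
  have hdc : ∀ δ : ℝ, 0 < δ → Tendsto (fun p : ℕ × ℕ => ∫⁻ x, ((ww δ (E (φ p.1)) x - ww δ (E (φ p.2)) x)
      + (ww δ (E (φ p.2)) x - ww δ (E (φ p.1)) x))) (atTop ×ˢ atTop) (nhds 0) := by
    intro δ hδ
    have hz : (0 : ℝ≥0∞) = ∫⁻ x : Euc d, 0 := by simp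
    rw [hz]
    have hwb : ∀ n x, ww δ (E n) x ≤
        (ball (0 : Euc d) (R + δ)).indicator (fun _ => volume (ball (0 : Euc d) δ)) x := by
      intro n x
      by_cases hx : x ∈ ball (0 : Euc d) (R + δ)
      · rw [indicator_of_mem hx]; exact measure_mono inter_subset_left
      · rw [indicator_of_notMem hx, nonpos_iff_eq_zero, ww_eq]
        convert measure_empty (μ := (volume : Measure (Euc d)))
        refine eq_empty_of_forall_notMem fun y hy => hx ?_
        have a := hR (hEU n hy.2)
        have b := hy.1
        rw [mem_ball] at *
        linarith [dist_triangle x y 0, dist_comm x y]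
    refine tendsto_lintegral_filter_of_dominated_convergence
      (fun x => 2 * (ball (0 : Euc d) (R + δ)).indicator (fun _ => volume (ball (0 : Euc d) δ)) x)
      ?_ ?_ ?_ ?_
    · refine Eventually.of_forall fun p => ?_
      have a := ww_meas δ (hE (φ p.1))
      have b := ww_meas δ (hE (φ p.2))
      exact ((a.sub b).add (b.sub a))
    · refine Eventually.of_forall fun p => Eventually.of_forall fun x => ?_
      rw [two_mul]
      exact add_le_add (tsub_le_self.trans (hwb _ _)) (tsub_le_self.trans (hwb _ _))
    · rw [lintegral_const_mul' _ _ (by simp), lintegral_indicator measurableSet_ball,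
        setLIntegral_const]
      exact ENNReal.mul_ne_top (by simp) (ENNReal.mul_ne_top measure_ball_lt_top.ne
        measure_ball_lt_top.ne)
    · refine Eventually.of_forall fun x => ?_
      obtain ⟨l, hl, hlt⟩ := hw (ball x δ) measurableSet_ball measure_ball_lt_top.ne
      simp_rw [← ww_eq] at hlt
      have a := hlt.comp (tendsto_fst (f := (atTop : Filter ℕ)) (g := (atTop : Filter ℕ)))
      have b := hlt.comp (tendsto_snd (f := (atTop : Filter ℕ)) (g := (atTop : Filter ℕ)))
      have := (ENNReal.Tendsto.sub a b (Or.inl hl)).add (ENNReal.Tendsto.sub b a (Or.inl hl))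
      simpa using this
  have hcau : ∀ ε : ℝ, 0 < ε → ∀ᶠ p : ℕ × ℕ in atTop ×ˢ atTop,
      volume (E (φ p.1) ∆ E (φ p.2)) ≤ ENNReal.ofReal (5 * ε) := by
    intro ε hε
    set δ := ε / (C + 1) with hδ
    have hδp : 0 < δ := by positivity
    have hCδ : C * δ ≤ ε := by
      rw [hδ, mul_div_assoc', div_le_iff₀ (by positivity)]; nlinarith
    set b := volume (ball (0 : Euc d) δ) with hb
    have hb0 : b ≠ 0 := (measure_ball_pos _ _ hδp).ne'
    have hbt : b ≠ ⊤ := measure_ball_lt_top.ne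
    have h1 : ∀ᶠ n in atTop, ∫⁻ h in ball (0 : Euc d) δ, GG (E (φ n)) h ≤ b * ENNReal.ofReal (2 * ε) := by
      have h0 : ∀ᶠ n in atTop, C * τ n < ε := by
        have := hτ.const_mul C
        rw [mul_zero] at this
        exact this.eventually_lt_const hε
      filter_upwards [hφ.tendsto_atTop.eventually h0, hφ.tendsto_atTop.eventually hG] with n hn hGn
      rw [mul_comm, ← setLIntegral_const]
      refine setLIntegral_mono' measurableSet_ball fun h hh => (hGn h).trans ?_
      apply ENNReal.ofReal_le_ofReal
      rw [mem_ball_zero_iff] at hh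
      nlinarith
    have h2 := (hdc δ hδp).eventually_lt_const (u := b * ENNReal.ofReal ε)
      (by rw [ENNReal.mul_pos_iff]; simp [hε, pos_iff_ne_zero, hb0])
    filter_upwards [h1.prod_mk h1, h2] with p hp hp2
    have h3 := key_bound δ (hE (φ p.1)) (hE (φ p.2))
    have h4 := h3.trans (add_le_add (add_le_add hp.1 hp.2) hp2.le)
    rw [← mul_add, ← mul_add, ← ENNReal.ofReal_add (by positivity) (by positivity),
      ← ENNReal.ofReal_add (by positivity) (by positivity)] at h4
    have h5 := (ENNReal.mul_le_mul_iff_right hb0 hbt).1 h4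
    refine h5.trans (ENNReal.ofReal_le_ofReal (by linarith))
  let x : ℕ → Lp ℝ 1 (volume : Measure (Euc d)) :=
    fun n => indicatorConstLp 1 (hE (φ n)) (hEt (φ n)) 1
  have hx : CauchySeq x := by
    rw [Metric.cauchySeq_iff]
    intro ε hε
    have := hcau (ε / 10) (by positivity)
    rw [prod_atTop_atTop_eq, eventually_atTop] at this
    obtain ⟨⟨N1, N2⟩, hN⟩ := this
    refine ⟨max N1 N2, fun m hm n hn => ?_⟩
    have h1 := hN (m, n) ⟨(le_max_left _ _).trans hm, (le_max_right _ _).trans hn⟩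
    rw [dist_indicatorConstLp_eq_norm, norm_indicatorConstLp (by simp) (by simp)]
    simp only [norm_one, one_mul, ENNReal.toReal_one, div_one, Real.rpow_one]
    have h2 := ENNReal.toReal_mono ENNReal.ofReal_ne_top h1
    rw [ENNReal.toReal_ofReal (by positivity)] at h2
    exact h2.trans_lt (by linarith)
  obtain ⟨u, hu⟩ := cauchySeq_tendsto_of_complete hx
  have hF : MeasurableSet {y | 1 / 2 < u y} :=
    measurableSet_lt measurable_const (Lp.stronglyMeasurable u).measurable
  have hle : ∀ n, volume (E (φ n) ∆ {y | 1 / 2 < u y}) ≤ 2 * edist (x n) u := by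
    intro n
    rw [Lp.edist_def, eLpNorm_one_eq_lintegral_enorm, ← lintegral_const_mul' _ _ (by simp),
      ← lintegral_indicator_one ((hE (φ n)).symmDiff hF)]
    refine lintegral_mono_ae ?_
    filter_upwards [indicatorConstLp_coeFn (p := 1) (hs := hE (φ n)) (hμs := hEt (φ n)) (c := (1:ℝ))]
      with y hy
    by_cases hm : y ∈ E (φ n) ∆ {y | 1 / 2 < u y}
    · rw [indicator_of_mem hm]
      have hz : (1:ℝ) / 2 ≤ ‖(⇑(x n) - ⇑u) y‖ := by
        have e : (⇑(x n) - ⇑u) y = (E (φ n)).indicator (fun _ => (1:ℝ)) y - u y := by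
          rw [← hy]; rfl
        rw [e, Real.norm_eq_abs]
        rcases hm with hm | hm
        · rw [indicator_of_mem hm.1]
          have : u y ≤ 1 / 2 := not_lt.1 hm.2
          exact le_trans (by linarith) (le_abs_self _)
        · rw [indicator_of_notMem hm.2]
          have : 1 / 2 < u y := hm.1
          exact le_trans (by linarith) (neg_le_abs _)
      rw [← ofReal_norm]
      calc (1 : Euc d → ℝ≥0∞) y = 2 * ENNReal.ofReal (1 / 2) := by
            rw [Pi.one_apply, ← ENNReal.ofReal_ofNat, ← ENNReal.ofReal_mul (by norm_num)]; norm_num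
        _ ≤ _ := by gcongr
    · rw [indicator_of_notMem hm]; exact zero_le
  have hlim : Tendsto (fun k => volume ((E (φ k)) ∆ {y | 1 / 2 < u y})) atTop (nhds 0) := by
    have h1 := ENNReal.Tendsto.const_mul (a := 2) ((tendsto_iff_edist_tendsto_0).1 hu) (Or.inr (by simp))
    rw [mul_zero] at h1
    exact tendsto_of_tendsto_of_tendsto_of_le_of_le tendsto_const_nhds h1 (fun _ => zero_le) hle
  refine ⟨_, hF, ?_, hlim⟩
  obtain ⟨n, hn⟩ := (hlim.eventually_lt_const (u := 1) (by simp)).exists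
  refine lt_of_le_of_lt (measure_mono ?_ |>.trans (measure_union_le (E (φ n)) (E (φ n) ∆ {y | 1 / 2 < u y})))
    (ENNReal.add_lt_top.2 ⟨(hEt _).lt_top, hn.trans (by simp)⟩)
  intro y hy
  by_cases h : y ∈ E (φ n)
  · exact Or.inl h
  · exact Or.inr (Or.inr ⟨hy, h⟩)

lemma diff_quot {d : ℕ} {F : Set (Euc d)} (hF : MeasurableSet F)
    {C : ℝ} (hC : 0 ≤ C) (hG : ∀ h, GG F h ≤ ENNReal.ofReal (C * ‖h‖))
    {f : Euc d → ℝ} (hf : Continuous f) (hfc : HasCompactSupport f) (hf1 : ∀ x, |f x| ≤ 1)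
    (v : Euc d) :
    |∫ x in F, (f (x + v) - f x)| ≤ C * ‖v‖ := by
  have hfi : Integrable f := hf.integrable_of_hasCompactSupport hfc
  have hfv : Integrable (fun x => f (x + v)) := hfi.comp_add_right v
  set A := (fun x => x + (-v)) ⁻¹' F with hA
  have hAm : MeasurableSet A := (measurable_add_const (-v)) hF
  have e1 : ∫ x in F, f (x + v) = ∫ x, A.indicator f x := by
    rw [← integral_indicator hF, ← integral_add_right_eq_self (A.indicator f) v]
    congr 1
    ext x
    by_cases hx : x ∈ F <;> simp [indicator, hA, hx]
  rw [integral_sub hfv.integrableOn hfi.integrableOn, e1, ← integral_indicator hF,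
    ← integral_sub (hfi.indicator hAm) (hfi.indicator hF)]
  have hfin : volume (F ∆ A) ≤ ENNReal.ofReal (C * ‖v‖) := by
    have := hG (-v)
    rwa [norm_neg] at this
  have hft : volume (F ∆ A) ≠ ⊤ := ne_top_of_le_ne_top (by simp) hfin
  have h1 : ‖∫ x, (A.indicator f x - F.indicator f x)‖ ≤
      ∫ x, (F ∆ A).indicator (fun _ => (1:ℝ)) x := by
    refine norm_integral_le_of_norm_le ?_ (Eventually.of_forall fun x => ?_)
    · exact (integrable_indicator_iff (hF.symmDiff hAm)).2 (integrableOn_const hft)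
    · have := hf1 x
      by_cases hx : x ∈ F <;> by_cases hy : x ∈ A <;> simp [indicator, hx, hy, mem_symmDiff, this]
  rw [Real.norm_eq_abs] at h1
  refine h1.trans ?_
  rw [integral_indicator_const _ (hF.symmDiff hAm), smul_eq_mul, mul_one]
  exact ENNReal.toReal_le_of_le_ofReal (by positivity) hfin

lemma per_fin {d : ℕ} {F : Set (Euc d)} (hF : MeasurableSet F) (hFt : volume F < ⊤)
    {C : ℝ} (hC : 0 ≤ C) (hG : ∀ h, GG F h ≤ ENNReal.ofReal (C * ‖h‖)) : Per d F < ⊤ := by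
  refine lt_of_le_of_lt (b := ENNReal.ofReal (d * C)) ?_ ENNReal.ofReal_lt_top
  refine iSup_le fun Φ => iSup_le fun hΦ => iSup_le fun hc => iSup_le fun h1 => ?_
  apply ENNReal.ofReal_le_ofReal
  have : Fact (volume F < ⊤) := ⟨hFt⟩
  have hcd : Continuous (fderiv ℝ Φ) := hΦ.continuous_fderiv (by simp)
  have hci : ∀ i : Fin d, Continuous fun x => fderiv ℝ Φ x (EuclideanSpace.single i 1) i := by
    intro i
    have : Continuous fun x => fderiv ℝ Φ x (EuclideanSpace.single i 1) := hcd.clm_apply continuous_const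
    exact (EuclideanSpace.proj (𝕜 := ℝ) i).continuous.comp this
  have hint : ∀ i : Fin d, Integrable (fun x => fderiv ℝ Φ x (EuclideanSpace.single i 1) i) := by
    intro i
    refine (hci i).integrable_of_hasCompactSupport ?_
    refine (hc.fderiv (𝕜 := ℝ)).comp_left (g := fun L : Euc d →L[ℝ] Euc d => L (EuclideanSpace.single i 1) i) ?_
    simp
  unfold diverg
  rw [integral_finsetSum _ fun i _ => (hint i).integrableOn]
  have key : ∀ i : Fin d, ∫ x in F, fderiv ℝ Φ x (EuclideanSpace.single i 1) i ≤ C := by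
    intro i
    set v : Euc d := EuclideanSpace.single i 1 with hv
    have hvn : ‖v‖ = 1 := by simp [hv]
    obtain ⟨K, hK⟩ := hΦ.lipschitzWith_of_hasCompactSupport hc (by simp)
    have hlim : Tendsto (fun t : ℝ => ∫ x in F, t⁻¹ * (Φ (x + t • v) i - Φ x i)) (nhdsWithin 0 (Ioi 0))
        (nhds (∫ x in F, fderiv ℝ Φ x v i)) := by
      refine tendsto_integral_filter_of_dominated_convergence (fun _ => (K : ℝ)) ?_ ?_ ?_ ?_
      · refine Eventually.of_forall fun t => ?_
        have hc' : Continuous fun x => t⁻¹ * (Φ (x + t • v) i - Φ x i) := by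
          have := hΦ.continuous
          fun_prop
        exact hc'.aestronglyMeasurable
      · filter_upwards [self_mem_nhdsWithin] with t ht
        refine Eventually.of_forall fun x => ?_
        have ht0 : 0 < t := ht
        have a1 : ‖Φ (x + t • v) i - Φ x i‖ ≤ ‖Φ (x + t • v) - Φ x‖ := by
          have := PiLp.norm_apply_le (Φ (x + t • v) - Φ x) i
          simpa using this
        have a2 := hK.dist_le_mul (x + t • v) x
        rw [dist_eq_norm, dist_eq_norm, add_sub_cancel_left, norm_smul, hvn, Real.norm_of_nonneg ht0.le,
          mul_one] at a2
        rw [norm_mul, norm_inv, Real.norm_of_nonneg ht0.le, inv_mul_le_iff₀ ht0]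
        linarith
      · exact integrable_const _
      · refine Eventually.of_forall fun x => ?_
        have hd := ((hΦ.differentiable (by simp) x).hasFDerivAt.hasLineDerivAt v).tendsto_slope_zero
        have := ((EuclideanSpace.proj (𝕜 := ℝ) i).continuous.tendsto _).comp hd
        have := this.mono_left (nhdsWithin_mono _ (fun t (ht : t ∈ Ioi (0:ℝ)) => ne_of_gt ht))
        refine this.congr fun t => ?_
        simp
    refine le_of_tendsto hlim ?_
    filter_upwards [self_mem_nhdsWithin] with t ht
    have ht0 : 0 < t := ht
    have hfc : HasCompactSupport fun x => Φ x i :=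
      hc.comp_left (g := fun y : Euc d => y i) (by simp)
    have hfcont : Continuous fun x => Φ x i := by
      have := hΦ.continuous
      fun_prop
    have := diff_quot hF hC hG hfcont hfc (fun x => (by
      have := PiLp.norm_apply_le (Φ x) i
      exact (this.trans (h1 x)))) (t • v)
    rw [norm_smul, hvn, Real.norm_of_nonneg ht0.le, mul_one] at this
    rw [integral_const_mul, inv_mul_le_iff₀ ht0, mul_comm t]
    exact (le_abs_self _).trans this
  refine (Finset.sum_le_sum fun i _ => key i).trans ?_
  simp

theorem stmt2 (d : ℕ) (hd : 2 ≤ d) (s : ℝ) (hs : 1 ≤ s)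
    (r : ℕ → ℝ) (hrpos : ∀ n, 0 < r n) (hr0 : Tendsto r atTop (nhds 0))
    (U : Set (Euc d)) (hUopen : IsOpen U) (hUbdd : Bornology.IsBounded U)
    (E : ℕ → Set (Euc d)) (hEmeas : ∀ n, MeasurableSet (E n)) (hEU : ∀ n, E n ⊆ U)
    (M : ℝ) (hM : ∀ n, Jt d s (r n) (E n) ≤ ENNReal.ofReal (M * sgm d s (r n))) :
    ∃ φ : ℕ → ℕ, StrictMono φ ∧ ∃ F : Set (Euc d), MeasurableSet F ∧
      volume F < ⊤ ∧ Per d F < ⊤ ∧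
      Tendsto (fun k => volume ((E (φ k)) ∆ F)) atTop (nhds 0) := by
  have hEt : ∀ n, volume (E n) ≠ ⊤ :=
    fun n => measure_ne_top_of_subset (hEU n) hUbdd.measure_lt_top.ne
  obtain ⟨C, hC, r0, hr0p, H⟩ := modulus hd hs M
  have hτ : Tendsto (fun n => √(r n)) atTop (nhds 0) := by
    have := (Real.continuous_sqrt.tendsto 0).comp hr0
    rwa [Real.sqrt_zero] at this
  have hG : ∀ᶠ n in atTop, ∀ h, GG (E n) h ≤ ENNReal.ofReal (C * (‖h‖ + √(r n))) := by
    filter_upwards [hr0.eventually_lt_const hr0p] with n hn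
    exact H (r n) (hrpos n) hn (E n) (hEmeas n) (hEt n) (hM n)
  obtain ⟨φ, hφ, F, hF, hFt, hlim⟩ := compact U hUbdd E hEmeas hEU C hC _ hτ hG
  refine ⟨φ, hφ, F, hF, hFt, per_fin hF hFt hC fun h => ?_, hlim⟩
  have hle : ∀ n, GG F h ≤ volume (E n ∆ F) + GG (E n) h + volume (E n ∆ F) := by
    intro n
    unfold GG
    have h1 : volume (E n ∆ F) = volume ((fun x => x + h) ⁻¹' (E n ∆ F)) :=
      (measure_preimage_add_right volume h _).symm
    nth_rw 2 [h1]
    refine (measure_mono ?_).trans ((measure_union_le _ _).trans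
      (add_le_add_left (measure_union_le _ _) _))
    intro x
    simp only [mem_symmDiff, mem_preimage, mem_union]
    tauto
  have ht : Tendsto (fun n => volume (E (φ n) ∆ F) + ENNReal.ofReal (C * (‖h‖ + √(r (φ n)))) +
      volume (E (φ n) ∆ F)) atTop (nhds (0 + ENNReal.ofReal (C * (‖h‖ + 0)) + 0)) :=
    (hlim.add (ENNReal.tendsto_ofReal
      (((hτ.comp hφ.tendsto_atTop).const_add ‖h‖).const_mul C))).add hlim
  simp only [zero_add, add_zero] at ht
  refine ge_of_tendsto ht ?_
  filter_upwards [hφ.tendsto_atTop.eventually hG] with n hn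
  exact (hle (φ n)).trans (by gcongr; exact hn h)


end
end

section
/- (Nonlocal Poincaré–Wirtinger inequality) Let d ≥ 2, s ≥ 1, and let 0 < r < l be such that ω_d·r^d ≤ l^d/2. Let ξ ∈ ℝ^d and let u ∈ L¹(lQ+ξ). Then ∫_{lQ+ξ} | u(y) − (1/|(lQ+ξ)∖B(y,r)|) ∫_{(lQ+ξ)∖B(y,r)} u(x) dx | dy ≤ 2·d^{(d+s)/2}·l^s · ∫_{lQ+ξ} ∫_{lQ+ξ} |u(y) − u(x)| k^s_r(|x−y|) dx dy. -/
open MeasureTheory Filter Set Metric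
open scoped ENNReal NNReal symmDiff

noncomputable section

lemma cube_eq_pre (d : ℕ) (l : ℝ) (ξ : Euc d) :
    cube d l ξ = (@WithLp.ofLp 2 (Fin d → ℝ)) ⁻¹'
      (Set.pi Set.univ fun i => Set.Ico (ξ i - l / 2) (ξ i + l / 2)) := by
  ext x; simp [cube]

lemma cube_meas (d : ℕ) (l : ℝ) (ξ : Euc d) : MeasurableSet (cube d l ξ) := by
  rw [cube_eq_pre]
  exact (PiLp.volume_preserving_ofLp (Fin d)).measurable
    (MeasurableSet.univ_pi fun i => measurableSet_Ico)

lemma cube_vol (d : ℕ) (l : ℝ) (hl : 0 < l) (ξ : Euc d) :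
    volume (cube d l ξ) = ENNReal.ofReal (l ^ d) := by
  rw [cube_eq_pre, (PiLp.volume_preserving_ofLp (Fin d)).measure_preimage
    (MeasurableSet.univ_pi fun i => measurableSet_Ico).nullMeasurableSet, Real.volume_pi_Ico]
  have : ∀ i : Fin d, ENNReal.ofReal (ξ i + l / 2 - (ξ i - l / 2)) = ENNReal.ofReal l := by
    intro i; congr 1; ring
  simp only [this]
  simp [ENNReal.ofReal_pow hl.le]

lemma cube_dist (d : ℕ) (l : ℝ) (hl : 0 < l) (ξ x y : Euc d) (hx : x ∈ cube d l ξ)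
    (hy : y ∈ cube d l ξ) : dist x y ≤ (d : ℝ) ^ ((1 : ℝ) / 2) * l := by
  rw [EuclideanSpace.dist_eq, ← Real.sqrt_eq_rpow, Real.sqrt_le_left (by positivity), mul_pow,
    Real.sq_sqrt (by positivity)]
  calc ∑ i, dist (x i) (y i) ^ 2 ≤ ∑ i : Fin d, l ^ 2 := by
        refine Finset.sum_le_sum fun i _ => ?_
        have h1 := hx i
        have h2 := hy i
        have : dist (x i) (y i) ≤ l := by
          rw [Real.dist_eq, abs_le]
          constructor <;> linarith [h1.1, h1.2, h2.1, h2.2]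
        gcongr
    _ = d * l ^ 2 := by simp

lemma cube_diff_vol (d : ℕ) (hd : 2 ≤ d) (r l : ℝ) (hr : 0 < r) (hrl : r < l)
    (hvol : omegaB d * r ^ d ≤ l ^ d / 2) (ξ y : Euc d) :
    l ^ d / 2 ≤ (volume (cube d l ξ \ ball y r)).toReal := by
  have hl : 0 < l := hr.trans hrl
  have hb : (volume (ball y r)).toReal = omegaB d * r ^ d := by
    rw [Measure.addHaar_ball_of_pos volume y hr, ENNReal.toReal_mul,
      ENNReal.toReal_ofReal (by positivity), omegaB, mul_comm]
    simp
  have hc : (volume (cube d l ξ)).toReal = l ^ d := by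
    rw [cube_vol d l hl, ENNReal.toReal_ofReal (by positivity)]
  have h := le_measure_sdiff (μ := volume) (s₁ := cube d l ξ) (s₂ := ball y r)
  have hfin : volume (cube d l ξ \ ball y r) ≠ ⊤ :=
    ne_top_of_le_ne_top (by rw [cube_vol d l hl]; exact ENNReal.ofReal_ne_top)
      (measure_mono sdiff_subset)
  have h2 := (ENNReal.toReal_mono hfin h)
  have h3 := ENNReal.le_toReal_sub (a := volume (cube d l ξ)) (b := volume (ball y r))
    measure_ball_lt_top.ne
  linarith

lemma ker_bound (d : ℕ) (hd : 2 ≤ d) (s : ℝ) (hs : 1 ≤ s)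
    (r l t : ℝ) (hr : 0 < r) (hl : 0 < l) (hrt : r ≤ t)
    (ht : t ≤ (d : ℝ) ^ ((1 : ℝ) / 2) * l) :
    2 / l ^ d ≤ 2 * (d : ℝ) ^ (((d : ℝ) + s) / 2) * l ^ s * ker d s r t := by
  have hd0 : (0 : ℝ) < d := by positivity
  have hk : ker d s r t = t ^ (-((d : ℝ) + s)) := by
    unfold _root_.ker
    split_ifs with h
    · rw [le_antisymm h hrt]
    · rfl
  have ht0 : 0 < t := hr.trans_le hrt
  have h1 : ((d : ℝ) ^ ((1 : ℝ) / 2) * l) ^ (-((d : ℝ) + s)) ≤ ker d s r t := by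
    rw [hk]
    exact Real.rpow_le_rpow_of_nonpos ht0 ht (by linarith)
  have h2 : ((d : ℝ) ^ ((1 : ℝ) / 2) * l) ^ (-((d : ℝ) + s)) =
      ((d : ℝ) ^ (((d : ℝ) + s) / 2) * (l ^ d * l ^ s))⁻¹ := by
    rw [Real.rpow_neg (by positivity), Real.mul_rpow (by positivity) hl.le,
      ← Real.rpow_mul hd0.le, Real.rpow_add hl, Real.rpow_natCast]
    congr 3
    ring
  rw [h2] at h1
  calc 2 / l ^ d = 2 * (d : ℝ) ^ (((d : ℝ) + s) / 2) * l ^ s *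
        ((d : ℝ) ^ (((d : ℝ) + s) / 2) * (l ^ d * l ^ s))⁻¹ := by
        have : (d : ℝ) ^ (((d : ℝ) + s) / 2) ≠ 0 := by positivity
        have : l ^ s ≠ 0 := by positivity
        field_simp
    _ ≤ _ := by gcongr

/-- **Nonlocal Poincaré–Wirtinger inequality.** -/
theorem stmt5 (d : ℕ) (hd : 2 ≤ d) (s : ℝ) (hs : 1 ≤ s)
    (r l : ℝ) (hr : 0 < r) (hrl : r < l) (hvol : omegaB d * r ^ d ≤ l ^ d / 2)
    (ξ : Euc d) (u : Euc d → ℝ) (hu : IntegrableOn u (cube d l ξ)) :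
    (∫⁻ y in cube d l ξ, ENNReal.ofReal
        |u y - (volume (cube d l ξ \ ball y r)).toReal⁻¹ *
            ∫ x in cube d l ξ \ ball y r, u x|) ≤
      ENNReal.ofReal (2 * (d : ℝ) ^ (((d : ℝ) + s) / 2) * l ^ s) *
        ∫⁻ y in cube d l ξ, ∫⁻ x in cube d l ξ,
          ENNReal.ofReal (|u y - u x| * ker d s r (dist x y)) := by
  have hl : 0 < l := hr.trans hrl
  rw [← lintegral_const_mul' _ _ ENNReal.ofReal_ne_top]
  refine setLIntegral_mono' (cube_meas d l ξ) fun y hy => ?_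
  rw [← lintegral_const_mul' _ _ ENNReal.ofReal_ne_top]
  set A := cube d l ξ \ ball y r with hA
  have hAm : MeasurableSet A := (cube_meas d l ξ).diff measurableSet_ball
  have hAC : A ⊆ cube d l ξ := sdiff_subset
  have hAfin : volume A ≠ ⊤ :=
    ne_top_of_le_ne_top (by rw [cube_vol d l hl]; exact ENNReal.ofReal_ne_top)
      (measure_mono hAC)
  have hV := cube_diff_vol d hd r l hr hrl hvol ξ y
  rw [← hA] at hV
  set V := (volume A).toReal with hVd
  have hV0 : 0 < V := lt_of_lt_of_le (by positivity) hV
  have huA : IntegrableOn u A := hu.mono_set hAC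
  have hcA : IntegrableOn (fun _ : Euc d => u y) A := integrableOn_const hAfin
  have hdA : IntegrableOn (fun x => u y - u x) A := hcA.sub huA
  have e1 : u y - V⁻¹ * ∫ x in A, u x = V⁻¹ * ∫ x in A, (u y - u x) := by
    rw [integral_sub hcA huA, setIntegral_const, smul_eq_mul, measureReal_def, ← hVd]
    field_simp
  have e2 : |u y - V⁻¹ * ∫ x in A, u x| ≤ 2 / l ^ d * ∫ x in A, |u y - u x| := by
    rw [e1, abs_mul, abs_of_pos (inv_pos.2 hV0)]
    have : V⁻¹ ≤ 2 / l ^ d := by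
      rw [inv_le_comm₀ hV0 (by positivity), inv_div]
      exact hV
    gcongr
    exact abs_integral_le_integral_abs
  calc _ ≤ ENNReal.ofReal (2 / l ^ d * ∫ x in A, |u y - u x|) := ENNReal.ofReal_le_ofReal e2
    _ = ∫⁻ x in A, ENNReal.ofReal (2 / l ^ d * |u y - u x|) := by
      rw [← integral_const_mul]
      exact ofReal_integral_eq_lintegral_ofReal (hdA.abs.const_mul _)
        (Eventually.of_forall fun x => by positivity)
    _ ≤ ∫⁻ x in A, ENNReal.ofReal (2 * (d : ℝ) ^ (((d : ℝ) + s) / 2) * l ^ s) *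
          ENNReal.ofReal (|u y - u x| * ker d s r (dist x y)) := by
      refine setLIntegral_mono' hAm fun x hx => ?_
      rw [← ENNReal.ofReal_mul (by positivity)]
      apply ENNReal.ofReal_le_ofReal
      have hb : r ≤ dist x y := by simpa using hx.2
      have := ker_bound d hd s hs r l (dist x y) hr hl hb (cube_dist d l hl ξ x y hx.1 hy)
      calc _ ≤ _ := mul_le_mul_of_nonneg_right this (abs_nonneg (u y - u x))
        _ = _ := by ring
    _ ≤ _ := lintegral_mono_set hAC

end
end
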